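/- Let α be a non-degenerate 3-form on ℝ⁶. Then λ_α = 0 if and only if there exists a linear isomorphism g : ℝ⁶ → ℝ⁶ with g*α = α_(iii). -/

import Mathlib

/-- `dx3 i j k` is the alternating 3-form `dxⁱ ∧ dxʲ ∧ dxᵏ` on `ℝ⁶ = Fin 6 → ℝ`. -/
noncomputable def dx3 (i j k : Fin 6) : AlternatingMap ℝ (Fin 6 → ℝ) ℝ (Fin 3) :=
  (Matrix.detRowAlternating : AlternatingMap ℝ (Fin 3 → ℝ) ℝ (Fin 3)).compLinearMap
    (LinearMap.funLeft ℝ ℝ ![i, j, k])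

/-- The volume form `dx¹ ∧ dx² ∧ dx³ ∧ dx⁴ ∧ dx⁵ ∧ dx⁶` on `ℝ⁶`. -/
noncomputable def dvol : AlternatingMap ℝ (Fin 6 → ℝ) ℝ (Fin 6) :=
  Matrix.detRowAlternating

/-- The wedge product of alternating forms on `ℝ⁶` (shuffle convention). -/
noncomputable def wedge {m n : ℕ} (a : AlternatingMap ℝ (Fin 6 → ℝ) ℝ (Fin m))
    (b : AlternatingMap ℝ (Fin 6 → ℝ) ℝ (Fin n)) :
    AlternatingMap ℝ (Fin 6 → ℝ) ℝ (Fin (m + n)) :=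
  (((TensorProduct.lid ℝ ℝ).toLinearMap.compAlternatingMap
    (AlternatingMap.domCoprod a b)).domDomCongr finSumFinEquiv)

/-- `α_(i) = dx^{123} + dx^{456}`. -/
noncomputable def alphaI : AlternatingMap ℝ (Fin 6 → ℝ) ℝ (Fin 3) :=
  dx3 0 1 2 + dx3 3 4 5

/-- `α_(ii) = dx^{135} − dx^{146} − dx^{236} − dx^{245}`. -/
noncomputable def alphaII : AlternatingMap ℝ (Fin 6 → ℝ) ℝ (Fin 3) :=
  dx3 0 2 4 - dx3 0 3 5 - dx3 1 2 5 - dx3 1 3 4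

/-- `α_(iii) = dx^{156} − dx^{246} + dx^{345}`. -/
noncomputable def alphaIII : AlternatingMap ℝ (Fin 6 → ℝ) ℝ (Fin 3) :=
  dx3 0 4 5 - dx3 1 3 5 + dx3 2 3 4

theorem apply_swap_left (α : AlternatingMap ℝ (Fin 6 → ℝ) ℝ (Fin 3)) (x y z : Fin 6 → ℝ) :
    α ![x, y, z] = -α ![y, x, z] := by
  rw [← α.map_swap _ (show (0 : Fin 3) ≠ 1 by decide)]
  congr 1
  ext l
  fin_cases l <;> rfl

theorem apply_swap_right (α : AlternatingMap ℝ (Fin 6 → ℝ) ℝ (Fin 3)) (x y z : Fin 6 → ℝ) :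
    α ![x, y, z] = -α ![x, z, y] := by
  rw [← α.map_swap _ (show (1 : Fin 3) ≠ 2 by decide)]
  congr 1
  ext l
  fin_cases l <;> rfl

open Equiv in
theorem sum_perm_fin_succ {n : ℕ} (f : Perm (Fin (n + 1)) → ℝ) :
    ∑ σ, f σ = ∑ i, ∑ σ, f (Perm.decomposeFin.symm (i, σ)) :=
  (Perm.decomposeFin.symm.sum_comp f).symm.trans (Fintype.sum_prod_type _)

theorem wedge_eq_lid_domCoprod {m n : ℕ} (a : AlternatingMap ℝ (Fin 6 → ℝ) ℝ (Fin m))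
    (b : AlternatingMap ℝ (Fin 6 → ℝ) ℝ (Fin n)) (w : Fin (m + n) → Fin 6 → ℝ) :
    wedge a b w = TensorProduct.lid ℝ ℝ (a.domCoprod b (w ∘ finSumFinEquiv)) :=
  rfl

theorem twelve_mul_wedge (a : AlternatingMap ℝ (Fin 6 → ℝ) ℝ (Fin 2))
    (b : AlternatingMap ℝ (Fin 6 → ℝ) ℝ (Fin 3)) (w : Fin 5 → Fin 6 → ℝ) :
    12 * wedge a b w = ∑ σ : Equiv.Perm (Fin 5), (Equiv.Perm.sign σ : ℝ) *
      (a ![w (σ 0), w (σ 1)] * b ![w (σ 2), w (σ 3), w (σ 4)]) := by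
  have h := congrArg (fun f => (TensorProduct.lid ℝ ℝ) (f (w ∘ finSumFinEquiv)))
    (MultilinearMap.domCoprod_alternization_eq a b)
  simp only [AlternatingMap.smul_apply, map_nsmul, MultilinearMap.alternatization_apply, map_sum] at h
  rw [wedge_eq_lid_domCoprod]
  simp only [Fintype.card_fin, nsmul_eq_mul] at h
  norm_num [Nat.factorial, -AlternatingMap.domCoprod_apply] at h
  rw [← h, ← (finSumFinEquiv (m := 2) (n := 3)).permCongr.sum_comp]
  refine Finset.sum_congr rfl fun σ _ => ?_
  rw [Equiv.Perm.sign_permCongr, Units.smul_def, zsmul_eq_mul]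
  congr 1
  congr 2
  · ext i; fin_cases i <;> rfl
  · ext i; fin_cases i <;> rfl

theorem wedge_apply (a : AlternatingMap ℝ (Fin 6 → ℝ) ℝ (Fin 2))
    (b : AlternatingMap ℝ (Fin 6 → ℝ) ℝ (Fin 3)) (w : Fin 5 → Fin 6 → ℝ) :
    wedge a b w =
      a ![w 0, w 1] * b ![w 2, w 3, w 4] - a ![w 0, w 2] * b ![w 1, w 3, w 4]
      + a ![w 0, w 3] * b ![w 1, w 2, w 4] - a ![w 0, w 4] * b ![w 1, w 2, w 3]
      + a ![w 1, w 2] * b ![w 0, w 3, w 4] - a ![w 1, w 3] * b ![w 0, w 2, w 4]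
      + a ![w 1, w 4] * b ![w 0, w 2, w 3] + a ![w 2, w 3] * b ![w 0, w 1, w 4]
      - a ![w 2, w 4] * b ![w 0, w 1, w 3] + a ![w 3, w 4] * b ![w 0, w 1, w 2] := by
  have h := twelve_mul_wedge a b w
  have ha (i j : Fin 5) (_ : j < i) : a ![w i, w j] = -a ![w j, w i] := by
    rw [← a.map_swap _ (zero_ne_one)]; congr 1; ext k; fin_cases k <;> rfl
  have hb (i j k : Fin 5) (_ : j < i) : b ![w i, w j, w k] = -b ![w j, w i, w k] := by
    rw [← b.map_swap _ (show (0 : Fin 3) ≠ 1 by decide)]; congr 1; ext l; fin_cases l <;> rfl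
  have hb' (i j k : Fin 5) (_ : k < j) : b ![w i, w j, w k] = -b ![w i, w k, w j] := by
    rw [← b.map_swap _ (show (1 : Fin 3) ≠ 2 by decide)]; congr 1; ext l; fin_cases l <;> rfl
  have hs (n : ℕ) (p : Fin (n + 1)) (σ : Equiv.Perm (Fin n)) (k : Fin n) :=
    Equiv.Perm.decomposeFin_symm_apply_succ σ p k
  have h1 (n : ℕ) (p : Fin (n + 2)) (σ) : Equiv.Perm.decomposeFin.symm (p, σ) 1 = _ := hs _ p σ 0
  have h2 (n : ℕ) (p : Fin (n + 3)) (σ) : Equiv.Perm.decomposeFin.symm (p, σ) 2 = _ := hs _ p σ 1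
  have h3 (n : ℕ) (p : Fin (n + 4)) (σ) : Equiv.Perm.decomposeFin.symm (p, σ) 3 = _ := hs _ p σ 2
  have h4 (n : ℕ) (p : Fin (n + 5)) (σ) : Equiv.Perm.decomposeFin.symm (p, σ) 4 = _ := hs _ p σ 3
  simp only [sum_perm_fin_succ, Fin.sum_univ_five, Fin.sum_univ_four, Fin.sum_univ_three,
    Fin.sum_univ_two, Fintype.sum_unique,
    Equiv.Perm.decomposeFin_symm_apply_zero, h1, h2, h3, h4, Equiv.Perm.decomposeFin.symm_sign] at h
  simp [Equiv.swap_apply_def] at h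
  simp (disch := decide) only [ha, hb, hb'] at h
  linarith

theorem dvol_apply (u : Fin 6 → Fin 6 → ℝ) : dvol u = Matrix.det (Matrix.of u) := by
  unfold dvol Matrix.det
  congr 1

theorem dvol_curryLeft_apply (x : Fin 6 → ℝ) (w : Fin 5 → Fin 6 → ℝ) :
    dvol.curryLeft x w = dvol (Matrix.vecCons x w) :=
  AlternatingMap.curryLeft_apply_apply dvol x w

theorem dvol_curryLeft_removeNth (x : Fin 6 → ℝ) (k : Fin 6) :
    dvol.curryLeft x (k.removeNth fun i => (Pi.single i 1 : Fin 6 → ℝ)) = (-1) ^ (k : ℕ) * x k := by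
  rw [dvol_curryLeft_apply, ← AlternatingMap.neg_one_pow_smul_map_insertNth,
    Fin.insertNth_removeNth, zsmul_eq_mul]
  push_cast
  congr 1
  have h : Matrix.of (Function.update (fun i => (Pi.single i 1 : Fin 6 → ℝ)) k x) =
      (1 : Matrix (Fin 6) (Fin 6) ℝ).updateRow k x := by
    ext i j
    rw [Matrix.of_apply, Matrix.updateRow_apply, Function.update_apply]
    split_ifs <;> simp [Matrix.one_apply, Pi.single_apply, eq_comm]
  rw [dvol_apply, h, ← Matrix.cramer_transpose_apply, Matrix.transpose_one, Matrix.cramer_one]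
  rfl

theorem apply_eq_sum_single (J : (Fin 6 → ℝ) →ₗ[ℝ] (Fin 6 → ℝ)) (x : Fin 6 → ℝ) (k : Fin 6) :
    J x k = ∑ i, x i * J (Pi.single i 1) k := by
  conv_lhs => rw [← Finset.univ_sum_single x, map_sum, Finset.sum_apply]
  refine Finset.sum_congr rfl fun i _ => ?_
  rw [← mul_one (x i), ← smul_eq_mul, Pi.single_smul, map_smul]
  simp

theorem compLinearMap_vec_apply (α : AlternatingMap ℝ (Fin 6 → ℝ) ℝ (Fin 3))
    (g : (Fin 6 → ℝ) →ₗ[ℝ] (Fin 6 → ℝ)) (x y z : Fin 6 → ℝ) :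
    α.compLinearMap g ![x, y, z] = α ![g x, g y, g z] := by
  rw [AlternatingMap.compLinearMap_apply]
  congr 1
  ext i
  fin_cases i <;> rfl

theorem curryLeft_vec_apply (α : AlternatingMap ℝ (Fin 6 → ℝ) ℝ (Fin 3)) (x y z : Fin 6 → ℝ) :
    α.curryLeft x ![y, z] = α ![x, y, z] :=
  rfl

/-- The coefficient of `e k` in `J (e i)`, where `J` is the endomorphism attached to the 3-form on
`ℝ⁶` with structure constants `c`. -/
def hitchinEntry (c : Fin 6 → Fin 6 → Fin 6 → ℝ) (i k : Fin 6) : ℝ :=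
  let w : Fin 5 → Fin 6 := k.succAbove
  (-1) ^ (k : ℕ) *
    (c i (w 0) (w 1) * c (w 2) (w 3) (w 4) - c i (w 0) (w 2) * c (w 1) (w 3) (w 4)
      + c i (w 0) (w 3) * c (w 1) (w 2) (w 4) - c i (w 0) (w 4) * c (w 1) (w 2) (w 3)
      + c i (w 1) (w 2) * c (w 0) (w 3) (w 4) - c i (w 1) (w 3) * c (w 0) (w 2) (w 4)
      + c i (w 1) (w 4) * c (w 0) (w 2) (w 3) + c i (w 2) (w 3) * c (w 0) (w 1) (w 4)
      - c i (w 2) (w 4) * c (w 0) (w 1) (w 3) + c i (w 3) (w 4) * c (w 0) (w 1) (w 2))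

theorem apply_single_eq_hitchinEntry {α : AlternatingMap ℝ (Fin 6 → ℝ) ℝ (Fin 3)}
    {J : (Fin 6 → ℝ) →ₗ[ℝ] (Fin 6 → ℝ)}
    (hJ : ∀ v : Fin 6 → ℝ, wedge (α.curryLeft v) α = dvol.curryLeft (J v)) (i k : Fin 6) :
    J (Pi.single i 1) k = hitchinEntry
      (fun i j k => α ![Pi.single i 1, Pi.single j 1, Pi.single k 1]) i k := by
  have h := (DFunLike.congr_fun (hJ (Pi.single i 1))
    (k.removeNth fun i => (Pi.single i 1 : Fin 6 → ℝ))).trans (dvol_curryLeft_removeNth _ k)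
  rw [wedge_apply] at h
  have hk : ((-1) ^ (k : ℕ) * (-1) ^ (k : ℕ) : ℝ) = 1 := by
    rw [← mul_pow, neg_one_mul, neg_neg, one_pow]
  calc
    J (Pi.single i 1) k = (-1) ^ (k : ℕ) * ((-1) ^ (k : ℕ) * J (Pi.single i 1) k) := by
      rw [← mul_assoc, hk, one_mul]
    _ = _ := by
      rw [← h]
      rfl

set_option maxHeartbeats 4000000 in
theorem sum_hitchinEntry_mul (c : Fin 6 → Fin 6 → Fin 6 → ℝ) (h₁ : ∀ i j k, c i j k = -c j i k)
    (h₂ : ∀ i j k, c i j k = -c i k j) (k : Fin 6) :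
    ∑ m, hitchinEntry c 0 m * hitchinEntry c m k =
      if k = 0 then (∑ i, ∑ m, hitchinEntry c i m * hitchinEntry c m i) / 6 else 0 := by
  have h₁' (i j k) (_ : j < i) : c i j k = -c j i k := h₁ i j k
  have h₂' (i j k) (_ : k < j) : c i j k = -c i k j := h₂ i j k
  have z₁ (i k) : c i i k = 0 := by linarith [h₁ i i k]
  have z₂ (i k) : c i k k = 0 := by linarith [h₂ i k k]
  have hs (k : Fin 6) (j : Fin 5) :
      k.succAbove j = if j.castSucc < k then j.castSucc else j.succ := rfl
  fin_cases k <;>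
  · simp [Fin.sum_univ_six]
    simp [hitchinEntry, hs]
    simp (disch := decide) only [h₁', h₂', z₁, z₂]
    ring

theorem trace_comp_self_eq_sum (J : (Fin 6 → ℝ) →ₗ[ℝ] (Fin 6 → ℝ)) :
    LinearMap.trace ℝ (Fin 6 → ℝ) (J ∘ₗ J) =
      ∑ i, ∑ m, J (Pi.single i 1) m * J (Pi.single m 1) i := by
  rw [LinearMap.trace_eq_matrix_trace ℝ (Pi.basisFun ℝ (Fin 6)), Matrix.trace]
  refine Finset.sum_congr rfl fun i _ => ?_
  rw [Matrix.diag_apply, LinearMap.toMatrix_apply, Pi.basisFun_apply, Pi.basisFun_repr,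
    LinearMap.comp_apply, apply_eq_sum_single]

theorem exists_ne_zero_apply_eq_zero {α : AlternatingMap ℝ (Fin 6 → ℝ) ℝ (Fin 3)}
    {J : (Fin 6 → ℝ) →ₗ[ℝ] (Fin 6 → ℝ)}
    (hJ : ∀ v : Fin 6 → ℝ, wedge (α.curryLeft v) α = dvol.curryLeft (J v))
    (htr : LinearMap.trace ℝ (Fin 6 → ℝ) (J ∘ₗ J) = 0) : ∃ v, v ≠ 0 ∧ J v = 0 := by
  have hJJ : J (J (Pi.single 0 1)) = 0 := by
    ext k
    have h := sum_hitchinEntry_mul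
      (fun i j k => α ![Pi.single i 1, Pi.single j 1, Pi.single k 1]) ?_ ?_ k
    · rw [trace_comp_self_eq_sum] at htr
      simp only [← apply_single_eq_hitchinEntry hJ, htr, zero_div, ite_self] at h
      rw [apply_eq_sum_single]
      exact h
    · intro i j k
      exact apply_swap_left α _ _ _
    · intro i j k
      exact apply_swap_right α _ _ _
  by_cases h0 : J (Pi.single 0 1) = 0
  · exact ⟨_, by simp, h0⟩
  · exact ⟨_, h0, hJJ⟩

theorem dx3_apply (i j k : Fin 6) (x y z : Fin 6 → ℝ) :
    dx3 i j k ![x, y, z] =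
      x i * (y j * z k - y k * z j) - x j * (y i * z k - y k * z i)
        + x k * (y i * z j - y j * z i) := by
  have h : dx3 i j k ![x, y, z] =
      Matrix.det !![x i, x j, x k; y i, y j, y k; z i, z j, z k] := by
    change Matrix.det (Matrix.of fun a => LinearMap.funLeft ℝ ℝ ![i, j, k] (![x, y, z] a)) = _
    congr 1
    ext a b
    fin_cases a <;> fin_cases b <;> rfl
  rw [h, Matrix.det_fin_three]
  simp
  ring

theorem alphaIII_apply (x y z : Fin 6 → ℝ) :
    alphaIII ![x, y, z] =
      (x 0 * (y 4 * z 5 - y 5 * z 4) - x 4 * (y 0 * z 5 - y 5 * z 0)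
        + x 5 * (y 0 * z 4 - y 4 * z 0))
      - (x 1 * (y 3 * z 5 - y 5 * z 3) - x 3 * (y 1 * z 5 - y 5 * z 1)
        + x 5 * (y 1 * z 3 - y 3 * z 1))
      + (x 2 * (y 3 * z 4 - y 4 * z 3) - x 3 * (y 2 * z 4 - y 4 * z 2)
        + x 4 * (y 2 * z 3 - y 3 * z 2)) := by
  simp only [alphaIII, AlternatingMap.add_apply, AlternatingMap.sub_apply, dx3_apply]

theorem trace_comp_self_eq_zero_of_alphaIII {J : (Fin 6 → ℝ) →ₗ[ℝ] (Fin 6 → ℝ)}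
    (hJ : ∀ v : Fin 6 → ℝ, wedge (alphaIII.curryLeft v) alphaIII = dvol.curryLeft (J v)) :
    LinearMap.trace ℝ (Fin 6 → ℝ) (J ∘ₗ J) = 0 := by
  have hs (k : Fin 6) (j : Fin 5) :
    k.succAbove j = if j.castSucc < k then j.castSucc else j.succ := rfl
  rw [trace_comp_self_eq_sum]
  simp only [apply_single_eq_hitchinEntry hJ]
  simp [Fin.sum_univ_six, hitchinEntry, hs, alphaIII_apply]

theorem detRowAlternating_comp {n : ℕ} (g : (Fin n → ℝ) →ₗ[ℝ] (Fin n → ℝ))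
    (u : Fin n → Fin n → ℝ) : (Matrix.detRowAlternating : AlternatingMap ℝ (Fin n → ℝ) ℝ (Fin n))
      (g ∘ u) = LinearMap.det g * Matrix.detRowAlternating u := by
  have h := (Pi.basisFun ℝ (Fin n)).det_comp g u
  rwa [Pi.basisFun_det] at h

theorem wedge_curryLeft_compLinearMap_apply (α : AlternatingMap ℝ (Fin 6 → ℝ) ℝ (Fin 3))
    (g : (Fin 6 → ℝ) ≃ₗ[ℝ] (Fin 6 → ℝ)) (v : Fin 6 → ℝ) (w : Fin 5 → Fin 6 → ℝ) :
    wedge ((α.compLinearMap (g : (Fin 6 → ℝ) →ₗ[ℝ] (Fin 6 → ℝ))).curryLeft v)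
        (α.compLinearMap (g : (Fin 6 → ℝ) →ₗ[ℝ] (Fin 6 → ℝ))) w =
      wedge (α.curryLeft (g v)) α (fun i : Fin 5 => g (w i)) := by
  rw [wedge_apply, wedge_apply]
  simp only [curryLeft_vec_apply, compLinearMap_vec_apply, LinearEquiv.coe_coe]

theorem dvol_curryLeft_comp (g : (Fin 6 → ℝ) ≃ₗ[ℝ] (Fin 6 → ℝ)) (x : Fin 6 → ℝ)
    (w : Fin 5 → Fin 6 → ℝ) :
    dvol.curryLeft x (fun i : Fin 5 => g (w i)) =
      LinearMap.det (g : (Fin 6 → ℝ) →ₗ[ℝ] (Fin 6 → ℝ)) * dvol.curryLeft (g.symm x) w := by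
  rw [dvol_curryLeft_apply, dvol_curryLeft_apply, dvol, ← detRowAlternating_comp]
  congr 1
  ext i : 1
  refine Fin.cases ?_ (fun i => ?_) i <;> simp

/-- Equivariance of the endomorphism attached to a 3-form under pullback. -/
theorem wedge_curryLeft_compLinearMap {α : AlternatingMap ℝ (Fin 6 → ℝ) ℝ (Fin 3)}
    {J : (Fin 6 → ℝ) →ₗ[ℝ] (Fin 6 → ℝ)}
    (hJ : ∀ v : Fin 6 → ℝ, wedge (α.curryLeft v) α = dvol.curryLeft (J v))
    (g : (Fin 6 → ℝ) ≃ₗ[ℝ] (Fin 6 → ℝ)) (v : Fin 6 → ℝ) :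
    wedge ((α.compLinearMap (g : (Fin 6 → ℝ) →ₗ[ℝ] (Fin 6 → ℝ))).curryLeft v)
        (α.compLinearMap (g : (Fin 6 → ℝ) →ₗ[ℝ] (Fin 6 → ℝ))) =
      dvol.curryLeft ((LinearMap.det (g : (Fin 6 → ℝ) →ₗ[ℝ] (Fin 6 → ℝ)) • g.symm.conj J) v) := by
  refine AlternatingMap.ext fun w => ?_
  rw [LinearMap.smul_apply, map_smul, AlternatingMap.smul_apply, smul_eq_mul]
  have h (x : Fin 6 → ℝ) (w : Fin 5 → Fin 6 → ℝ) :
      wedge (α.curryLeft x) α w = dvol.curryLeft (J x) w := DFunLike.congr_fun (hJ x) w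
  refine (wedge_curryLeft_compLinearMap_apply α _ v w).trans ((h _ _).trans ?_)
  refine (dvol_curryLeft_comp g (J (g v)) w).trans ?_
  rw [LinearEquiv.conj_apply_apply, LinearEquiv.symm_symm]

theorem trace_comp_self_eq_zero_of_compLinearMap {α : AlternatingMap ℝ (Fin 6 → ℝ) ℝ (Fin 3)}
    {J : (Fin 6 → ℝ) →ₗ[ℝ] (Fin 6 → ℝ)}
    (hJ : ∀ v : Fin 6 → ℝ, wedge (α.curryLeft v) α = dvol.curryLeft (J v))
    (g : (Fin 6 → ℝ) ≃ₗ[ℝ] (Fin 6 → ℝ))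
    (hg : α.compLinearMap (g : (Fin 6 → ℝ) →ₗ[ℝ] (Fin 6 → ℝ)) = alphaIII) :
    LinearMap.trace ℝ (Fin 6 → ℝ) (J ∘ₗ J) = 0 := by
  have h := trace_comp_self_eq_zero_of_alphaIII
    (fun v => hg ▸ wedge_curryLeft_compLinearMap hJ g v)
  rw [LinearMap.smul_comp, LinearMap.comp_smul, ← LinearEquiv.conj_comp, map_smul, map_smul,
    LinearMap.trace_conj'] at h
  have hdet : LinearMap.det (g : (Fin 6 → ℝ) →ₗ[ℝ] (Fin 6 → ℝ)) ≠ 0 :=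
    (LinearEquiv.isUnit_det' g).ne_zero
  simpa [hdet] using h

theorem apply_add_left (α : AlternatingMap ℝ (Fin 6 → ℝ) ℝ (Fin 3)) (x x' y z : Fin 6 → ℝ) :
    α ![x + x', y, z] = α ![x, y, z] + α ![x', y, z] :=
  α.map_vecCons_add ![y, z] x x'

theorem apply_smul_left (α : AlternatingMap ℝ (Fin 6 → ℝ) ℝ (Fin 3)) (c : ℝ) (x y z : Fin 6 → ℝ) :
    α ![c • x, y, z] = c * α ![x, y, z] :=
  α.map_vecCons_smul ![y, z] c x

theorem apply_add_mid (α : AlternatingMap ℝ (Fin 6 → ℝ) ℝ (Fin 3)) (x y y' z : Fin 6 → ℝ) :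
    α ![x, y + y', z] = α ![x, y, z] + α ![x, y', z] := by
  rw [apply_swap_left, apply_add_left, neg_add, ← apply_swap_left, ← apply_swap_left]

theorem apply_smul_mid (α : AlternatingMap ℝ (Fin 6 → ℝ) ℝ (Fin 3)) (c : ℝ) (x y z : Fin 6 → ℝ) :
    α ![x, c • y, z] = c * α ![x, y, z] := by
  rw [apply_swap_left, apply_smul_left, ← mul_neg, ← apply_swap_left]

theorem apply_add_right (α : AlternatingMap ℝ (Fin 6 → ℝ) ℝ (Fin 3)) (x y z z' : Fin 6 → ℝ) :
    α ![x, y, z + z'] = α ![x, y, z] + α ![x, y, z'] := by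
  rw [apply_swap_right, apply_add_mid, neg_add, ← apply_swap_right, ← apply_swap_right]

theorem apply_smul_right (α : AlternatingMap ℝ (Fin 6 → ℝ) ℝ (Fin 3)) (c : ℝ)
    (x y z : Fin 6 → ℝ) : α ![x, y, c • z] = c * α ![x, y, z] := by
  rw [apply_swap_right, apply_smul_mid, ← mul_neg, ← apply_swap_right]

theorem apply_self_left (α : AlternatingMap ℝ (Fin 6 → ℝ) ℝ (Fin 3)) (x y : Fin 6 → ℝ) :
    α ![x, x, y] = 0 := by
  linarith [apply_swap_left α x x y]

theorem apply_self_right (α : AlternatingMap ℝ (Fin 6 → ℝ) ℝ (Fin 3)) (x y : Fin 6 → ℝ) :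
    α ![x, y, y] = 0 := by
  linarith [apply_swap_right α x y y]

/-- The linear form `x ↦ α(x, y, z)`. -/
def sliceForm (α : AlternatingMap ℝ (Fin 6 → ℝ) ℝ (Fin 3)) (y z : Fin 6 → ℝ) :
    (Fin 6 → ℝ) →ₗ[ℝ] ℝ where
  toFun x := α ![x, y, z]
  map_add' x x' := apply_add_left α x x' y z
  map_smul' c x := apply_smul_left α c x y z

theorem exists_apply_eq_one {α : AlternatingMap ℝ (Fin 6 → ℝ) ℝ (Fin 3)}
    (hα : Function.Injective (fun v : Fin 6 → ℝ => α.curryLeft v)) {v : Fin 6 → ℝ} (hv : v ≠ 0) :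
    ∃ p q, α ![v, p, q] = 1 := by
  by_contra! h
  refine hv (hα (AlternatingMap.ext fun w => ?_))
  have hw : (w : Fin 2 → Fin 6 → ℝ) = ![w 0, w 1] := by
    ext i : 1
    fin_cases i <;> rfl
  beta_reduce
  rw [map_zero, AlternatingMap.zero_apply, hw]
  by_contra h0
  refine h ((α ![v, w 0, w 1])⁻¹ • w 0) (w 1) ?_
  rw [apply_smul_mid]
  exact inv_mul_cancel₀ h0

/-- If `ι_v α ∧ α = 0` and `α(v, p, q) = 1`, then `ℝ⁶` is the direct sum of `⟨v, p, q⟩` and a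
three-dimensional space on which `α` is controlled by `ι_p α` and `ι_q α`. -/
theorem exists_complement {α : AlternatingMap ℝ (Fin 6 → ℝ) ℝ (Fin 3)} {v p q : Fin 6 → ℝ}
    (hv : wedge (α.curryLeft v) α = 0) (h1 : α ![v, p, q] = 1) :
    ∃ E : (Fin 3 → ℝ) →ₗ[ℝ] (Fin 6 → ℝ), Function.Injective E ∧
      (∀ y, ∃ (a b c : ℝ) (x : Fin 3 → ℝ), y = a • v + b • p + c • q + E x) ∧
      (∀ x, α ![v, p, E x] = 0) ∧ (∀ x, α ![v, q, E x] = 0) ∧ (∀ x, α ![p, q, E x] = 0) ∧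
      (∀ x y, α ![v, E x, E y] = 0) ∧ ∀ x y z, α ![E x, E y, E z] = 0 := by
  have hstar (w : Fin 5 → Fin 6 → ℝ) := (wedge_apply (α.curryLeft v) α w).symm.trans
    (DFunLike.congr_fun hv w)
  simp only [curryLeft_vec_apply, AlternatingMap.zero_apply] at hstar
  let T : (Fin 6 → ℝ) →ₗ[ℝ] (Fin 3 → ℝ) :=
    LinearMap.pi ![sliceForm α v p, sliceForm α v q, sliceForm α p q]
  have hT (y : Fin 6 → ℝ) : T y = ![α ![y, v, p], α ![y, v, q], α ![y, p, q]] := by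
    ext i
    fin_cases i <;> rfl
  have hS (c : Fin 3 → ℝ) : T (c 2 • v + (-c 1) • p + c 0 • q) = c := by
    rw [hT]
    ext i
    fin_cases i <;>
      simp [apply_add_left, apply_smul_left, apply_self_left, apply_self_right,
        apply_swap_left α p v, apply_swap_left α q v, apply_swap_left α q p,
        apply_swap_right α v q p, h1, -neg_smul]
  have hsurj : LinearMap.range T = ⊤ := LinearMap.range_eq_top.2 fun c => ⟨_, hS c⟩
  have hrank : Module.finrank ℝ (Fin 3 → ℝ) = Module.finrank ℝ (LinearMap.ker T) := by
    have h := T.finrank_range_add_finrank_ker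
    rw [hsurj, finrank_top] at h
    simp at h ⊢
    omega
  let e := LinearEquiv.ofFinrankEq (Fin 3 → ℝ) (LinearMap.ker T) hrank
  have hE (x : Fin 3 → ℝ) : ![α ![(e x : Fin 6 → ℝ), v, p], α ![(e x : Fin 6 → ℝ), v, q],
      α ![(e x : Fin 6 → ℝ), p, q]] = 0 := (hT _).symm.trans (e x).2
  have hp (x : Fin 3 → ℝ) : α ![v, p, (e x : Fin 6 → ℝ)] = 0 := by
    rw [apply_swap_right, apply_swap_left, neg_neg]
    exact congrFun (hE x) 0
  have hq (x : Fin 3 → ℝ) : α ![v, q, (e x : Fin 6 → ℝ)] = 0 := by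
    rw [apply_swap_right, apply_swap_left, neg_neg]
    exact congrFun (hE x) 1
  have hpq (x : Fin 3 → ℝ) : α ![p, q, (e x : Fin 6 → ℝ)] = 0 := by
    rw [apply_swap_right, apply_swap_left, neg_neg]
    exact congrFun (hE x) 2
  have hvE (x y : Fin 3 → ℝ) : α ![v, (e x : Fin 6 → ℝ), (e y : Fin 6 → ℝ)] = 0 := by
    have h := hstar ![v, p, q, e x, e y]
    simp [apply_self_left, h1, hp, hq] at h
    linarith
  refine ⟨(LinearMap.ker T).subtype ∘ₗ e.toLinearMap, ?_, fun y => ?_, hp, hq, hpq, hvE,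
    fun x y z => ?_⟩
  · exact (Submodule.subtype_injective _).comp e.injective
  · have hy : y - (T y 2 • v + (-T y 1) • p + T y 0 • q) ∈ LinearMap.ker T := by
      rw [LinearMap.mem_ker, map_sub, hS, sub_self]
    refine ⟨T y 2, -T y 1, T y 0, e.symm ⟨_, hy⟩, ?_⟩
    simp
  · have h := hstar ![p, q, e x, e y, e z]
    simp [h1, hp, hq, hvE] at h
    exact h

open Matrix in
theorem exists_eq_dotProduct_crossProduct (β : AlternatingMap ℝ (Fin 3 → ℝ) ℝ (Fin 2)) :
    ∃ A : Fin 3 → ℝ, ∀ x y, β ![x, y] = A ⬝ᵥ (x ⨯₃ y) := by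
  have add_left (x x' y) : β ![x + x', y] = β ![x, y] + β ![x', y] :=
    β.map_vecCons_add ![y] x x'
  have smul_left (c : ℝ) (x y) : β ![c • x, y] = c * β ![x, y] := β.map_vecCons_smul ![y] c x
  have swap (x y) : β ![x, y] = -β ![y, x] := by
    rw [← β.map_swap _ (zero_ne_one)]
    congr 1
    ext i : 1
    fin_cases i <;> rfl
  have add_right (x y y') : β ![x, y + y'] = β ![x, y] + β ![x, y'] := by
    rw [swap, add_left, neg_add, ← swap, ← swap]
  have smul_right (c : ℝ) (x y) : β ![x, c • y] = c * β ![x, y] := by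
    rw [swap, smul_left, ← mul_neg, ← swap]
  have self (x) : β ![x, x] = 0 := by linarith [swap x x]
  let e : Fin 3 → Fin 3 → ℝ := fun i => Pi.single i 1
  have hx (x : Fin 3 → ℝ) : x = x 0 • e 0 + x 1 • e 1 + x 2 • e 2 := by
    ext i
    fin_cases i <;> simp [e]
  refine ⟨![β ![e 1, e 2], β ![e 2, e 0], β ![e 0, e 1]], fun x y => ?_⟩
  conv_lhs => rw [hx x, hx y]
  simp only [add_left, add_right, smul_left, smul_right, self, swap (e 1) (e 0), swap (e 2) (e 1),
    swap (e 0) (e 2)]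
  simp [cross_apply]
  ring

theorem ext_of_lt {a b : AlternatingMap ℝ (Fin 6 → ℝ) ℝ (Fin 3)}
    (h : ∀ i j k : Fin 6, i < j → j < k →
      a ![Pi.single i 1, Pi.single j 1, Pi.single k 1] =
        b ![Pi.single i 1, Pi.single j 1, Pi.single k 1]) : a = b := by
  refine (Pi.basisFun ℝ (Fin 6)).ext_alternating fun v hv => ?_
  have hm : StrictMono (v ∘ Tuple.sort v) :=
    (Tuple.monotone_sort v).strictMono_of_injective (hv.comp (Tuple.sort v).injective)
  have hs := h _ _ _ (hm (show (0 : Fin 3) < 1 by decide)) (hm (show (1 : Fin 3) < 2 by decide))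
  have he : (![Pi.single ((v ∘ Tuple.sort v) 0) 1, Pi.single ((v ∘ Tuple.sort v) 1) 1,
      Pi.single ((v ∘ Tuple.sort v) 2) 1] : Fin 3 → Fin 6 → ℝ) =
      (fun i => Pi.basisFun ℝ (Fin 6) (v i)) ∘ Tuple.sort v := by
    ext i : 1
    fin_cases i <;> simp
  rw [he, AlternatingMap.map_perm, AlternatingMap.map_perm] at hs
  exact smul_left_cancel _ hs

theorem exists_equiv_of_frame {α : AlternatingMap ℝ (Fin 6 → ℝ) ℝ (Fin 3)} (f : Fin 6 → Fin 6 → ℝ)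
    (hf : ∀ i j k : Fin 6, i < j → j < k → α ![f i, f j, f k] =
      alphaIII ![Pi.single i 1, Pi.single j 1, Pi.single k 1]) :
    ∃ g : (Fin 6 → ℝ) ≃ₗ[ℝ] (Fin 6 → ℝ),
      α.compLinearMap (g : (Fin 6 → ℝ) →ₗ[ℝ] (Fin 6 → ℝ)) = alphaIII := by
  let g : (Fin 6 → ℝ) →ₗ[ℝ] (Fin 6 → ℝ) := (Pi.basisFun ℝ (Fin 6)).constr ℝ f
  have hgf (i : Fin 6) : g (Pi.single i 1) = f i := by
    rw [← Pi.basisFun_apply]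
    exact (Pi.basisFun ℝ (Fin 6)).constr_basis ℝ f i
  have hg : α.compLinearMap g = alphaIII := by
    refine ext_of_lt fun i j k hij hjk => ?_
    rw [compLinearMap_vec_apply, hgf, hgf, hgf, hf i j k hij hjk]
  have hinj : Function.Injective g := by
    refine (injective_iff_map_eq_zero g).2 fun x hx => ?_
    have h (j k : Fin 6) : alphaIII ![x, Pi.single j 1, Pi.single k 1] = 0 := by
      rw [← hg, compLinearMap_vec_apply, hx]
      exact AlternatingMap.map_coord_zero _ 0 rfl
    simp only [alphaIII_apply] at h
    have h0 := h 4 5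
    have h1 := h 3 5
    have h2 := h 3 4
    have h3 := h 2 4
    have h4 := h 2 3
    have h5 := h 0 4
    simp at h0 h1 h2 h3 h4 h5
    ext i
    fin_cases i <;> assumption
  exact ⟨LinearEquiv.ofInjectiveEndo g hinj, hg⟩

open Matrix in
theorem exists_equiv_of_wedge_eq_zero {α : AlternatingMap ℝ (Fin 6 → ℝ) ℝ (Fin 3)}
    (hα : Function.Injective (fun v : Fin 6 → ℝ => α.curryLeft v)) {v : Fin 6 → ℝ} (hv0 : v ≠ 0)
    (hv : wedge (α.curryLeft v) α = 0) :
    ∃ g : (Fin 6 → ℝ) ≃ₗ[ℝ] (Fin 6 → ℝ),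
      α.compLinearMap (g : (Fin 6 → ℝ) →ₗ[ℝ] (Fin 6 → ℝ)) = alphaIII := by
  obtain ⟨p, q, h1⟩ := exists_apply_eq_one hα hv0
  obtain ⟨E, hE, hdec, hvpE, hvqE, hpqE, hvEE, hEEE⟩ := exists_complement hv h1
  obtain ⟨A, hA⟩ := exists_eq_dotProduct_crossProduct ((α.curryLeft p).compLinearMap E)
  obtain ⟨B, hB⟩ := exists_eq_dotProduct_crossProduct ((α.curryLeft q).compLinearMap E)
  replace hA (x y : Fin 3 → ℝ) : α ![p, E x, E y] = A ⬝ᵥ (x ⨯₃ y) := by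
    rw [← hA]
    refine congrArg α ?_
    ext i : 1
    fin_cases i <;> rfl
  replace hB (x y : Fin 3 → ℝ) : α ![q, E x, E y] = B ⬝ᵥ (x ⨯₃ y) := by
    rw [← hB]
    refine congrArg α ?_
    ext i : 1
    fin_cases i <;> rfl
  have hEp (x y) : α ![E x, p, y] = -α ![p, E x, y] := apply_swap_left _ _ _ _
  have hEq (x y) : α ![E x, q, y] = -α ![q, E x, y] := apply_swap_left _ _ _ _
  have hEp' (x y) : α ![y, E x, p] = -α ![y, p, E x] := apply_swap_right _ _ _ _
  have hEq' (x y) : α ![y, E x, q] = -α ![y, q, E x] := apply_swap_right _ _ _ _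
  have hEv' (x y) : α ![y, E x, v] = -α ![y, v, E x] := apply_swap_right _ _ _ _
  have hker (x : Fin 3 → ℝ) (hxA : ∀ y, A ⬝ᵥ (x ⨯₃ y) = 0) (hxB : ∀ y, B ⬝ᵥ (x ⨯₃ y) = 0) :
      x = 0 := by
    refine hE (hα (AlternatingMap.ext fun w => ?_))
    have hw : (w : Fin 2 → Fin 6 → ℝ) = ![w 0, w 1] := by
      ext i : 1
      fin_cases i <;> rfl
    beta_reduce
    rw [map_zero, map_zero, AlternatingMap.zero_apply, hw, curryLeft_vec_apply]
    obtain ⟨a, b, c, y, hy⟩ := hdec (w 0)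
    obtain ⟨a', b', c', z, hz⟩ := hdec (w 1)
    rw [hy, hz]
    simp only [apply_add_mid, apply_add_right, apply_smul_mid, apply_smul_right, apply_self_left,
      apply_swap_left α (E _) v, hEp, hEq, hEv', hEp', hEq', apply_swap_left α p v,
      apply_swap_left α q v, apply_swap_left α q p,
      hvpE, hvqE, hpqE, hvEE, hEEE, hA, hB, hxA, hxB]
    simp
  have hAB : A ⨯₃ B ≠ 0 := by
    intro h0
    have hA0 : A = 0 := hker A (fun y => dot_self_cross A y) fun y => by
      rw [triple_product_permutation, triple_product_permutation, ← cross_anticomm, h0, neg_zero,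
        dotProduct_zero]
    have hB0 : B = 0 := hker B (fun y => by rw [hA0, zero_dotProduct]) fun y => dot_self_cross B y
    exact one_ne_zero (hker 1 (fun y => by rw [hA0, zero_dotProduct])
      fun y => by rw [hB0, zero_dotProduct])
  obtain ⟨N, hN⟩ : ∃ N, N = (A ⨯₃ B) ⬝ᵥ (A ⨯₃ B) := ⟨_, rfl⟩
  have hN0 : N ≠ 0 := by
    rw [hN]
    exact fun h => hAB (dotProduct_self_eq_zero.1 h)
  have hNA : A ⬝ᵥ (B ⨯₃ (A ⨯₃ B)) = N := by
    rw [triple_product_permutation, triple_product_permutation, hN]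
  have hNB : B ⬝ᵥ (A ⨯₃ (A ⨯₃ B)) = -N := by
    rw [triple_product_permutation, triple_product_permutation, ← cross_anticomm A B,
      dotProduct_neg, hN]
  refine exists_equiv_of_frame ![v, N⁻¹ • E A, N⁻¹ • E B, E (A ⨯₃ B), p, q]
    fun i j k hij hjk => ?_
  fin_cases i <;> fin_cases j <;> try (exact absurd hij (by decide))
  all_goals
    fin_cases k <;> try (exact absurd hjk (by decide))
  all_goals
    simp [alphaIII_apply, apply_smul_left, apply_smul_mid, apply_smul_right, hEp, hEq, hEp', hEq',
      h1, hvpE, hvqE, hpqE, hvEE, hEEE, hA, hB, hNA, hNB, hN0]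

/-- For a non-degenerate 3-form α on ℝ⁶ with invariant λ_α = trace(J_α ∘ J_α),
where J_α is determined by (ι_v α) ∧ α = ι_{J_α v} dvol, the stated sign condition
on λ_α holds iff α lies in the GL₆(ℝ)-orbit of the corresponding normal form. -/
theorem linear_type_criterion (α : AlternatingMap ℝ (Fin 6 → ℝ) ℝ (Fin 3))
    (hα : Function.Injective (fun v : Fin 6 → ℝ => α.curryLeft v))
    (J : (Fin 6 → ℝ) →ₗ[ℝ] (Fin 6 → ℝ))
    (hJ : ∀ v : Fin 6 → ℝ, wedge (α.curryLeft v) α = dvol.curryLeft (J v)) :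
    (LinearMap.trace ℝ (Fin 6 → ℝ) (J ∘ₗ J) = 0) ↔
      ∃ g : (Fin 6 → ℝ) ≃ₗ[ℝ] (Fin 6 → ℝ),
        α.compLinearMap (g : (Fin 6 → ℝ) →ₗ[ℝ] (Fin 6 → ℝ)) = alphaIII := by
  refine ⟨fun htr => ?_, fun ⟨g, hg⟩ => trace_comp_self_eq_zero_of_compLinearMap hJ g hg⟩
  obtain ⟨v, hv0, hv⟩ := exists_ne_zero_apply_eq_zero hJ htr
  exact exists_equiv_of_wedge_eq_zero hα hv0 (by rw [hJ, hv, map_zero])
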